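/- Let p be a prime, let V ⊆ ℂ^ℕ be a finite-dimensional ℂ-subspace spanned by its integer points, let V_p ⊆ 𝔽_p^ℕ be the image of V ∩ ℤ^ℕ under coordinatewise reduction modulo p, and let S ⊆ ℕ. Then dim_ℂ (V ∩ ker π_S) ≤ dim_{𝔽_p} (V_p ∩ ker π̄_S), where π_S : ℂ^ℕ → ℂ^S and π̄_S : 𝔽_p^ℕ → 𝔽_p^S are the restriction maps to S. -/

import Mathlib

/-- Integer-valued functions whose reductions modulo a prime are linearly independent are
linearly independent over `ℤ`. -/
theorem linearIndependent_int_of_zmod {ι X : Type*} {p : ℕ} (hp : p.Prime) {b : ι → X → ℤ}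
    (hb : LinearIndependent (ZMod p) fun i x => (b i x : ZMod p)) :
    LinearIndependent ℤ b := by
  classical
  rw [linearIndependent_iff'] at hb ⊢
  intro s c hc
  by_contra! hne
  obtain ⟨i, hi, hci⟩ := hne
  obtain ⟨g, hg, hgcd⟩ := Finset.extract_gcd c ⟨i, hi⟩
  have hs : s.gcd c ≠ 0 := fun h => hci (Finset.gcd_eq_zero_iff.1 h i hi)
  have hsum : ∀ x, ∑ j ∈ s, g j * b j x = 0 := by
    intro x
    have h := congrFun hc x
    simp only [Finset.sum_apply, Pi.smul_apply, smul_eq_mul, Pi.zero_apply] at h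
    rw [Finset.sum_congr rfl fun j hj => by rw [hg j hj, mul_assoc], ← Finset.mul_sum] at h
    exact (mul_eq_zero.1 h).resolve_left hs
  have hdvd : ∀ j ∈ s, (p : ℤ) ∣ g j := by
    intro j hj
    rw [← ZMod.intCast_zmod_eq_zero_iff_dvd]
    refine hb s (fun j => (g j : ZMod p)) ?_ j hj
    ext x
    simpa using congrArg (Int.cast : ℤ → ZMod p) (hsum x)
  have h1 : (p : ℤ) ∣ 1 := hgcd ▸ Finset.dvd_gcd hdvd
  exact hp.one_lt.ne' (by exact_mod_cast Int.eq_one_of_dvd_one (by positivity) h1)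

/-- Integer-valued functions that are linearly independent over `ℤ` are linearly independent
over any field of characteristic zero. -/
theorem LinearIndependent.intCast_comp {ι X : Type*} (K : Type*) [Field K] [CharZero K]
    {b : ι → X → ℤ} (hb : LinearIndependent ℤ b) :
    LinearIndependent K fun i x => (b i x : K) := by
  have hQ : LinearIndependent ℚ fun i x => (b i x : ℚ) := by
    rw [← LinearIndependent.iff_fractionRing ℤ ℚ]
    let F : (X → ℤ) →ₗ[ℤ] (X → ℚ) := (Algebra.linearMap ℤ ℚ).compLeft X
    refine hb.map' F (LinearMap.ker_eq_bot.2 fun f g h => ?_)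
    ext x
    simpa [F] using congrFun h x
  rw [linearIndependent_iff'] at hQ ⊢
  intro s c hc i hi
  rw [← Module.forall_dual_apply_eq_zero_iff ℚ]
  intro φ
  refine hQ s (fun j => φ (c j)) ?_ i hi
  ext x
  have h := congrArg φ (congrFun hc x)
  simp only [Finset.sum_apply, Pi.smul_apply, smul_eq_mul, Pi.zero_apply, map_sum, map_zero] at h ⊢
  rw [← h]
  refine Finset.sum_congr rfl fun j _ => ?_
  simpa [zsmul_eq_mul, mul_comm] using (map_zsmul φ (b j x) (c j)).symm

/-- A space of functions modulo `p` all of whose members lift to integer points of a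
finite-dimensional space `V` is finite-dimensional, of dimension at most that of `V`. -/
theorem finite_and_finrank_le_of_forall_exists_lift {X : Type*} {p : ℕ} [Fact p.Prime]
    {K : Type*} [Field K] [CharZero K]
    (V : Submodule K (X → K)) [FiniteDimensional K V] (W : Submodule (ZMod p) (X → ZMod p))
    (h : ∀ w ∈ W, ∃ f : X → ℤ, (fun x => (f x : K)) ∈ V ∧ w = fun x => (f x : ZMod p)) :
    Module.Finite (ZMod p) W ∧ Module.finrank (ZMod p) W ≤ Module.finrank K V := by
  choose! f hfV hf using h
  have hrank : Module.rank (ZMod p) W ≤ (Module.finrank K V : ℕ) := by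
    refine rank_le fun s hs => ?_
    have h1 : LinearIndependent (ZMod p) fun (i : s) x => (f (i : W) x : ZMod p) := by
      have heq : (fun (i : s) x => (f (i : W) x : ZMod p)) = W.subtype ∘ Subtype.val :=
        funext fun i => (hf _ i.1.2).symm
      rw [heq]
      exact hs.map' W.subtype W.ker_subtype
    have h2 := (linearIndependent_int_of_zmod (Fact.out : p.Prime) h1).intCast_comp K
    have h3 : LinearIndependent K
        fun i : s => (⟨fun x => (f (i : W) x : K), hfV _ i.1.2⟩ : V) :=
      LinearIndependent.of_comp V.subtype h2
    simpa using h3.fintype_card_le_finrank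
  have hfin : Module.Finite (ZMod p) W :=
    Module.rank_lt_aleph0_iff.1 (hrank.trans_lt Cardinal.natCast_lt_aleph0)
  exact ⟨hfin, by rw [← Module.finrank_eq_rank] at hrank; exact_mod_cast hrank⟩

/-- A finite-dimensional space of functions on `ℕ` is determined by finitely many coordinates. -/
theorem exists_forall_lt_eq_zero_imp_eq_zero {K : Type*} [Field K]
    (V : Submodule K (ℕ → K)) [FiniteDimensional K V] :
    ∃ n : ℕ, ∀ v ∈ V, (∀ i < n, v i = 0) → v = 0 := by
  let F : ℕ →o (Submodule K V)ᵒᵈ :=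
    { toFun := fun n => OrderDual.toDual
        { carrier := {v | ∀ i < n, (v : ℕ → K) i = 0}
          add_mem' := fun ha hb i hi => by simp [ha i hi, hb i hi]
          zero_mem' := fun i _ => rfl
          smul_mem' := fun c v hv i hi => by simp [hv i hi] }
      monotone' := fun m n hmn v hv i hi => hv i (hi.trans_le hmn) }
  obtain ⟨n, hn⟩ := IsArtinian.monotone_stabilizes F
  refine ⟨n, fun v hv h => funext fun i => ?_⟩
  have h1 : (⟨v, hv⟩ : V) ∈ OrderDual.ofDual (F n) := h
  rw [hn (max n (i + 1)) (le_max_left _ _)] at h1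
  exact h1 i (by simp)

/-- The integer points of a space of functions, as a `ℤ`-module. -/
def Submodule.integerPoints {X K : Type*} [Field K] (V : Submodule K (X → K)) :
    Submodule ℤ (X → ℤ) :=
  (V.restrictScalars ℤ).comap ((Algebra.linearMap ℤ K).compLeft X)

theorem Submodule.mem_integerPoints {X K : Type*} [Field K] {V : Submodule K (X → K)}
    {f : X → ℤ} : f ∈ V.integerPoints ↔ (fun x => (f x : K)) ∈ V :=
  Iff.rfl

theorem Submodule.finite_integerPoints {K : Type*} [Field K] [CharZero K]
    (V : Submodule K (ℕ → K)) [FiniteDimensional K V] : Module.Finite ℤ V.integerPoints := by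
  obtain ⟨n, hn⟩ := exists_forall_lt_eq_zero_imp_eq_zero V
  let F : V.integerPoints →ₗ[ℤ] (Fin n → ℤ) :=
    LinearMap.funLeft ℤ ℤ (Fin.val : Fin n → ℕ) ∘ₗ V.integerPoints.subtype
  have hF : Function.Injective F := by
    refine (injective_iff_map_eq_zero F).2 fun f hf => Subtype.ext (funext fun i => ?_)
    have h := hn _ (mem_integerPoints.1 f.2) fun i hi => by
      have h2 : (f : ℕ → ℤ) i = 0 := congrFun hf ⟨i, hi⟩
      simp [h2]
    exact (Int.cast_eq_zero (α := K)).1 (congrFun h i)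
  exact Module.Finite.of_injective F hF

/-- If `V` is spanned by its integer points, all of which reduce into `W`, then
`dim V ≤ dim W`. -/
theorem finrank_le_finrank_of_integerPoints {K : Type*} [Field K] [CharZero K] {p : ℕ}
    [Fact p.Prime] (V : Submodule K (ℕ → K)) [FiniteDimensional K V]
    (hV : V ≤ Submodule.span K ((fun f x => ((f x : ℤ) : K)) '' (V.integerPoints : Set (ℕ → ℤ))))
    (W : Submodule (ZMod p) (ℕ → ZMod p)) [Module.Finite (ZMod p) W]
    (hW : ∀ f ∈ V.integerPoints, (fun x => (f x : ZMod p)) ∈ W) :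
    Module.finrank K V ≤ Module.finrank (ZMod p) W := by
  have := V.finite_integerPoints
  let b := Module.finBasis ℤ V.integerPoints
  have hspan : V ≤ Submodule.span K (Set.range fun i x => ((b i : ℕ → ℤ) x : K)) := by
    refine hV.trans (Submodule.span_le.2 ?_)
    rintro _ ⟨f, hf, rfl⟩
    have h : (fun x => (f x : K)) =
        ∑ i, (b.repr ⟨f, hf⟩ i : K) • fun x => ((b i : ℕ → ℤ) x : K) := by
      ext x
      have h1 := congrArg (fun g : V.integerPoints => (((g : ℕ → ℤ) x : ℤ) : K))
        (b.sum_repr ⟨f, hf⟩)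
      simpa [-Module.Basis.sum_repr] using h1.symm
    simp only [h]
    exact Submodule.sum_mem _ fun i _ =>
      Submodule.smul_mem _ _ (Submodule.subset_span ⟨i, rfl⟩)
  have hle : Module.finrank K V ≤ Module.finrank ℤ V.integerPoints := by
    have h1 := finrank_range_le_card (R := K) fun i x => ((b i : ℕ → ℤ) x : K)
    rw [Fintype.card_fin] at h1
    have := FiniteDimensional.span_of_finite K
      (Set.finite_range fun i x => ((b i : ℕ → ℤ) x : K))
    exact (Submodule.finrank_mono hspan).trans h1
  refine hle.trans ?_
  have hind : LinearIndependent (ZMod p)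
      fun i => (⟨fun x => ((b i : ℕ → ℤ) x : ZMod p), hW _ (b i).2⟩ : W) := by
    rw [Fintype.linearIndependent_iff]
    intro c hc i
    choose a ha using fun i => ZMod.intCast_surjective (c i)
    have hdvd : ∀ x, (p : ℤ) ∣ ((∑ j, a j • b j : V.integerPoints) : ℕ → ℤ) x := by
      intro x
      rw [← ZMod.intCast_zmod_eq_zero_iff_dvd]
      have h := congrFun (congrArg Subtype.val hc) x
      simpa [ha] using h
    choose g hg using hdvd
    have hp0 : (p : K) ≠ 0 := Nat.cast_ne_zero.2 (Fact.out : p.Prime).ne_zero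
    have hgV : g ∈ V.integerPoints := by
      have h := Submodule.mem_integerPoints.1 (∑ j, a j • b j : V.integerPoints).2
      refine (V.smul_mem_iff hp0).1 ?_
      convert h using 1
      ext x
      rw [hg x]
      simp
    have hsum : (∑ j, a j • b j : V.integerPoints) = (p : ℤ) • ⟨g, hgV⟩ :=
      Subtype.ext (funext fun x => by simpa using hg x)
    have hai : a i = p * b.repr ⟨g, hgV⟩ i := by
      have h := congrArg (fun v => b.repr v i) hsum
      simp only [b.repr_sum_self, map_smul, Finsupp.smul_apply, smul_eq_mul] at h
      exact h
    rw [← ha, hai]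
    simp
  simpa using hind.fintype_card_le_finrank

/-- Rank-nullity for a linear map restricted to a submodule. -/
theorem Submodule.finrank_map_add_finrank_inf_ker {K M N : Type*} [Field K] [AddCommGroup M]
    [Module K M] [AddCommGroup N] [Module K N] (V : Submodule K M) [FiniteDimensional K V]
    (f : M →ₗ[K] N) :
    Module.finrank K (V.map f) + Module.finrank K ↥(V ⊓ LinearMap.ker f) =
      Module.finrank K V := by
  have h := (f.domRestrict V).finrank_range_add_finrank_ker
  rw [LinearMap.range_domRestrict, LinearMap.ker_domRestrict,
    ← Submodule.finrank_map_subtype_eq, Submodule.map_comap_subtype] at h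
  exact h


/-- Let `p` be a prime, `V ⊆ ℂ^ℕ` a finite-dimensional ℂ-subspace
spanned by its integer points, `Vp ⊆ 𝔽_p^ℕ` the image of `V ∩ ℤ^ℕ` under
coordinatewise reduction modulo `p`, and `S ⊆ ℕ`.  Then
`dim_ℂ (V ∩ ker π_S) ≤ dim_{𝔽_p} (Vp ∩ ker π̄_S)`. -/
theorem finrank_inf_ker_le_finrank_inf_ker_reduction
    (p : ℕ) (hp : p.Prime)
    (V : Submodule ℂ (ℕ → ℂ)) (hVfin : FiniteDimensional ℂ V)
    (hVspan : V = Submodule.span ℂ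
      {v : ℕ → ℂ | v ∈ V ∧ ∀ n : ℕ, ∃ m : ℤ, v n = (m : ℂ)})
    (Vp : Submodule (ZMod p) (ℕ → ZMod p))
    (hVp : (Vp : Set (ℕ → ZMod p)) =
      {w : ℕ → ZMod p | ∃ f : ℕ → ℤ,
        (fun n : ℕ => (f n : ℂ)) ∈ V ∧ w = fun n : ℕ => ((f n : ZMod p))})
    (S : Set ℕ) :
    Module.finrank ℂ
        ↥(V ⊓ LinearMap.ker (LinearMap.funLeft ℂ ℂ ((↑) : S → ℕ))) ≤
      Module.finrank (ZMod p)
        ↥(Vp ⊓ LinearMap.ker (LinearMap.funLeft (ZMod p) (ZMod p) ((↑) : S → ℕ))) := by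
  have := Fact.mk hp
  have hlift : ∀ w ∈ Vp, ∃ f : ℕ → ℤ,
      (fun n => (f n : ℂ)) ∈ V ∧ w = fun n => (f n : ZMod p) := by
    intro w hw
    rw [← SetLike.mem_coe, hVp] at hw
    exact hw
  have hred : ∀ f ∈ V.integerPoints, (fun n => (f n : ZMod p)) ∈ Vp := by
    intro f hf
    rw [← SetLike.mem_coe, hVp]
    exact ⟨f, hf, rfl⟩
  have hspan : V ≤ Submodule.span ℂ
      ((fun f n => ((f n : ℤ) : ℂ)) '' (V.integerPoints : Set (ℕ → ℤ))) := by
    refine hVspan.le.trans (Submodule.span_mono ?_)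
    rintro v ⟨hv, hvint⟩
    choose f hf using hvint
    obtain rfl : v = fun n => (f n : ℂ) := funext hf
    exact ⟨f, hv, rfl⟩
  have hfin := (finite_and_finrank_le_of_forall_exists_lift V Vp hlift).1
  have hdim := finrank_le_finrank_of_integerPoints V hspan Vp hred
  have hmap := (finite_and_finrank_le_of_forall_exists_lift
    (V.map (LinearMap.funLeft ℂ ℂ ((↑) : S → ℕ)))
    (Vp.map (LinearMap.funLeft (ZMod p) (ZMod p) ((↑) : S → ℕ))) (by
      rintro _ ⟨w, hw, rfl⟩
      obtain ⟨f, hf, rfl⟩ := hlift w hw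
      exact ⟨fun x => f x, ⟨_, hf, rfl⟩, rfl⟩)).2
  have h1 := V.finrank_map_add_finrank_inf_ker (LinearMap.funLeft ℂ ℂ ((↑) : S → ℕ))
  have h2 := Vp.finrank_map_add_finrank_inf_ker
    (LinearMap.funLeft (ZMod p) (ZMod p) ((↑) : S → ℕ))
  omega
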